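/- Let C = {x_1, …, x_M} ⊂ ℝ^d be a finite set of distinct points and let x_i ∈ C, with d_ij = ‖x_i − x_j‖ for j ≠ i. Then there exist constants K > 0 and γ₀ > 0 such that for all 0 < γ < γ₀, the conditional symbol error probability satisfies P_e(x_i;γ) ≤ (2γ/π)·Σ_{j ≠ i} 1/d_ij + K·γ³. -/

import Mathlib

open MeasureTheory Real Filter
open scoped RealInnerProductSpace Topology

noncomputable def cC (d : ℕ) : ℝ :=
  Real.Gamma (((d : ℝ) + 1) / 2) / Real.pi ^ (((d : ℝ) + 1) / 2)

noncomputable def fC (d : ℕ) (γ : ℝ) (n : EuclideanSpace ℝ (Fin d)) : ℝ :=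
  cC d * γ ^ (-(d : ℝ)) * (1 + ‖n‖ ^ 2 / γ ^ 2) ^ (-(((d : ℝ) + 1) / 2))

/-- The Voronoi cell of `x` in the constellation `C`. -/
def vor {d : ℕ} (C : Set (EuclideanSpace ℝ (Fin d))) (x : EuclideanSpace ℝ (Fin d)) :
    Set (EuclideanSpace ℝ (Fin d)) := {y | ∀ c ∈ C, ‖y - x‖ ≤ ‖y - c‖}

/-- The Voronoi cell of `x` translated by `-x`. -/
def vorT {d : ℕ} (C : Set (EuclideanSpace ℝ (Fin d))) (x : EuclideanSpace ℝ (Fin d)) :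
    Set (EuclideanSpace ℝ (Fin d)) := (fun y => y - x) '' vor C x

/-- Conditional symbol error probability `P_e(x;γ)`. -/
noncomputable def Pe {d : ℕ} (C : Set (EuclideanSpace ℝ (Fin d)))
    (x : EuclideanSpace ℝ (Fin d)) (γ : ℝ) : ℝ :=
  ∫ n in (vorT C x)ᶜ, fC d γ n


lemma integral_halfSpace_exp_neg_mul_sq_norm {ι E : Type*} [Fintype ι] [NormedAddCommGroup E]
    [InnerProductSpace ℝ E] [FiniteDimensional ℝ E] [MeasurableSpace E] [BorelSpace E]
    (B : OrthonormalBasis ι ℝ E) (i : ι) (b h : ℝ) :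
    ∫ n in {n : E | h < ⟪B i, n⟫}, rexp (-b * ‖n‖ ^ 2)
      = √(π / b) ^ (Fintype.card ι - 1) * ∫ v in Set.Ioi h, rexp (-b * v ^ 2) := by
  classical
  have hm : MeasurableSet {n : E | h < ⟪B i, n⟫} := by measurability
  rw [← integral_indicator hm, ← B.measurePreserving_measurableEquiv.symm.integral_comp',
    ← (PiLp.volume_preserving_toLp ι).integral_comp
      (MeasurableEquiv.toLp 2 (ι → ℝ)).measurableEmbedding]
  let f : ι → ℝ → ℝ := fun j v ↦
    if j = i then (Set.Ioi h).indicator (fun v ↦ rexp (-b * v ^ 2)) v else rexp (-b * v ^ 2)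
  have hf : ∀ y : ι → ℝ, {n : E | h < ⟪B i, n⟫}.indicator (fun n ↦ rexp (-b * ‖n‖ ^ 2))
      (B.measurableEquiv.symm (WithLp.toLp 2 y)) = ∏ j, f j (y j) := by
    intro y
    have e : B.measurableEquiv.symm (WithLp.toLp 2 y) = B.repr.symm (WithLp.toLp 2 y) := rfl
    have hin : ⟪B i, B.repr.symm (WithLp.toLp 2 y)⟫ = y i := by
      rw [← B.repr_apply_apply]; simp
    have hexp : rexp (-b * ‖B.repr.symm (WithLp.toLp 2 y)‖ ^ 2)
        = ∏ j, rexp (-b * y j ^ 2) := by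
      rw [LinearIsometryEquiv.norm_map, EuclideanSpace.real_norm_sq_eq, Finset.mul_sum, exp_sum]
    rw [e]
    by_cases hy : h < y i
    · rw [Set.indicator_of_mem (by simpa [hin] using hy), hexp]
      refine Finset.prod_congr rfl fun j _ ↦ ?_
      by_cases hj : j = i
      · subst hj; simp [f, hy]
      · simp [f, hj]
    · rw [Set.indicator_of_notMem (by simpa [hin] using hy)]
      exact (Finset.prod_eq_zero (Finset.mem_univ i) (by simp [f, hy])).symm
  simp_rw [hf]
  rw [integral_fintype_prod_volume_eq_prod f, ← Finset.mul_prod_erase _ _ (Finset.mem_univ i),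
    mul_comm]
  congr 1
  · rw [Finset.prod_congr rfl (g := fun _ ↦ √(π / b))]
    · simp
    · intro j hj
      simp [f, Finset.ne_of_mem_erase hj, ← integral_gaussian]
  · simp [f, integral_indicator measurableSet_Ioi]

lemma lintegral_halfSpace_exp_neg_mul_sq_norm {ι E : Type*} [Fintype ι] [NormedAddCommGroup E]
    [InnerProductSpace ℝ E] [FiniteDimensional ℝ E] [MeasurableSpace E] [BorelSpace E]
    (B : OrthonormalBasis ι ℝ E) (i : ι) {b : ℝ} (hb : 0 < b) (h : ℝ) :
    ∫⁻ n in {n : E | h < ⟪B i, n⟫}, ENNReal.ofReal (rexp (-b * ‖n‖ ^ 2))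
      = ENNReal.ofReal (√(π / b) ^ (Fintype.card ι - 1)) *
        ∫⁻ v in Set.Ioi h, ENNReal.ofReal (rexp (-b * v ^ 2)) := by
  have hint : Integrable (fun n : E ↦ rexp (-b * ‖n‖ ^ 2)) :=
    .of_integral_ne_zero (by
      rw [GaussianFourier.integral_rexp_neg_mul_sq_norm hb]
      positivity)
  rw [← ofReal_integral_eq_lintegral_ofReal hint.integrableOn (ae_of_all _ fun _ ↦ by positivity),
    ← ofReal_integral_eq_lintegral_ofReal (integrable_exp_neg_mul_sq hb).integrableOn
      (ae_of_all _ fun _ ↦ by positivity),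
    integral_halfSpace_exp_neg_mul_sq_norm, ENNReal.ofReal_mul (by positivity)]

lemma lintegral_rpow_mul_exp_neg_mul_Ioi {a r : ℝ} (ha : 0 < a) (hr : 0 < r) :
    ∫⁻ s in Set.Ioi (0 : ℝ), ENNReal.ofReal (s ^ (a - 1) * rexp (-(r * s)))
      = ENNReal.ofReal (r ^ (-a) * Real.Gamma a) := by
  have key := integral_rpow_mul_exp_neg_mul_Ioi ha hr
  have hpos := Gamma_pos_of_pos ha
  have hint : IntegrableOn (fun s ↦ s ^ (a - 1) * rexp (-(r * s))) (Set.Ioi 0) :=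
    .of_integral_ne_zero (by rw [key]; positivity)
  rw [← ofReal_integral_eq_lintegral_ofReal hint, key, one_div, inv_rpow hr.le, rpow_neg hr.le]
  filter_upwards [ae_restrict_mem measurableSet_Ioi] with s hs
  have : (0 : ℝ) < s := hs
  positivity

lemma lintegral_Ioi_inv_one_add_sq_le {γ h : ℝ} (hγ : 0 < γ) (hh : 0 < h) :
    ∫⁻ v in Set.Ioi h, ENNReal.ofReal ((1 + v ^ 2 / γ ^ 2)⁻¹) ≤ ENNReal.ofReal (γ ^ 2 / h) := by
  have hint : IntegrableOn (fun v : ℝ ↦ γ ^ 2 * v ^ (-2 : ℝ)) (Set.Ioi h) :=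
    (integrableOn_Ioi_rpow_of_lt (by norm_num) hh).const_mul _
  have hval : ∫ v in Set.Ioi h, γ ^ 2 * v ^ (-2 : ℝ) = γ ^ 2 / h := by
    rw [integral_const_mul, integral_Ioi_rpow_of_lt (by norm_num) hh]
    norm_num [rpow_neg_one, div_eq_mul_inv]
  rw [← hval, ofReal_integral_eq_lintegral_ofReal hint]
  · refine setLIntegral_mono' measurableSet_Ioi fun v hv ↦ ENNReal.ofReal_le_ofReal ?_
    have hv0 : 0 < v := hh.trans hv
    rw [rpow_neg hv0.le, rpow_two, ← div_eq_mul_inv, inv_le_comm₀ (by positivity) (by positivity),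
      inv_div]
    linarith
  · filter_upwards [ae_restrict_mem measurableSet_Ioi] with v hv
    have : 0 < v := hh.trans hv
    positivity

lemma lintegral_halfSpace_rpow_le {ι E : Type*} [Fintype ι] [NormedAddCommGroup E]
    [InnerProductSpace ℝ E] [FiniteDimensional ℝ E] [MeasurableSpace E] [BorelSpace E]
    (B : OrthonormalBasis ι ℝ E) (i : ι) {γ h p : ℝ} (hγ : 0 < γ) (hh : 0 < h)
    (hp : p = ((Fintype.card ι : ℝ) + 1) / 2) :
    ENNReal.ofReal (Real.Gamma p) *
      ∫⁻ n in {n : E | h < ⟪B i, n⟫}, ENNReal.ofReal ((1 + ‖n‖ ^ 2 / γ ^ 2) ^ (-p))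
      ≤ ENNReal.ofReal ((√π * γ) ^ (Fintype.card ι - 1) * (γ ^ 2 / h)) := by
  set m := Fintype.card ι - 1 with hm
  have hcard : Fintype.card ι = m + 1 := by
    have : 0 < Fintype.card ι := Fintype.card_pos_iff.2 ⟨i⟩
    omega
  have hpm : p - 1 = (m : ℝ) / 2 := by rw [hp, hcard]; push_cast; ring
  have hp0 : 0 < p := by have : (0 : ℝ) ≤ m := m.cast_nonneg; linarith
  have hΓ := Gamma_pos_of_pos hp0
  calc
    _ = ∫⁻ n in {n : E | h < ⟪B i, n⟫}, ∫⁻ s in Set.Ioi (0 : ℝ),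
          ENNReal.ofReal (s ^ (p - 1) * rexp (-((1 + ‖n‖ ^ 2 / γ ^ 2) * s))) := by
      rw [← lintegral_const_mul' _ _ ENNReal.ofReal_ne_top]
      refine lintegral_congr fun n ↦ ?_
      rw [lintegral_rpow_mul_exp_neg_mul_Ioi hp0 (by positivity), mul_comm,
        ENNReal.ofReal_mul (by positivity)]
    _ = ∫⁻ s in Set.Ioi (0 : ℝ), ∫⁻ n in {n : E | h < ⟪B i, n⟫},
          ENNReal.ofReal (s ^ (p - 1) * rexp (-((1 + ‖n‖ ^ 2 / γ ^ 2) * s))) :=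
      lintegral_lintegral_swap (by fun_prop)
    _ = ∫⁻ s in Set.Ioi (0 : ℝ), ∫⁻ v in Set.Ioi h, ENNReal.ofReal ((√π * γ) ^ m) *
          ENNReal.ofReal (s ^ ((1 : ℝ) - 1) * rexp (-((1 + v ^ 2 / γ ^ 2) * s))) := by
      refine setLIntegral_congr_fun measurableSet_Ioi fun s (hs : 0 < s) ↦ ?_
      have hsplit : ∀ c t : ℝ, 0 ≤ c → ENNReal.ofReal (c * rexp (-((1 + t / γ ^ 2) * s)))
          = ENNReal.ofReal (c * rexp (-s)) * ENNReal.ofReal (rexp (-(s / γ ^ 2) * t)) := by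
        intro c t hc
        rw [← ENNReal.ofReal_mul (by positivity), mul_assoc, ← Real.exp_add]
        congr 3
        ring
      have hscale : s ^ (p - 1) * √(π / (s / γ ^ 2)) ^ m = (√π * γ) ^ m := by
        have h1 : s ^ (p - 1) = √s ^ m := by
          rw [hpm, sqrt_eq_rpow, ← rpow_natCast, ← rpow_mul hs.le]
          congr 1; ring
        rw [h1, ← mul_pow, ← sqrt_mul hs.le]
        congr 1
        rw [show s * (π / (s / γ ^ 2)) = π * γ ^ 2 by field_simp, sqrt_mul pi_pos.le,
          sqrt_sq hγ.le]
      simp_rw [sub_self, rpow_zero, hsplit _ _ (rpow_nonneg hs.le _), hsplit _ _ zero_le_one]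
      rw [lintegral_const_mul' _ _ ENNReal.ofReal_ne_top,
        lintegral_const_mul' _ _ ENNReal.ofReal_ne_top,
        lintegral_const_mul' _ _ ENNReal.ofReal_ne_top,
        lintegral_halfSpace_exp_neg_mul_sq_norm B i (by positivity), ← hscale,
        ← mul_assoc, ← mul_assoc, ← ENNReal.ofReal_mul (by positivity),
        ← ENNReal.ofReal_mul (by positivity)]
      congr 2
      ring
    _ = ∫⁻ v in Set.Ioi h, ∫⁻ s in Set.Ioi (0 : ℝ), ENNReal.ofReal ((√π * γ) ^ m) *
          ENNReal.ofReal (s ^ ((1 : ℝ) - 1) * rexp (-((1 + v ^ 2 / γ ^ 2) * s))) :=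
      lintegral_lintegral_swap (by fun_prop)
    _ = ENNReal.ofReal ((√π * γ) ^ m) *
          ∫⁻ v in Set.Ioi h, ENNReal.ofReal ((1 + v ^ 2 / γ ^ 2)⁻¹) := by
      rw [← lintegral_const_mul' _ _ ENNReal.ofReal_ne_top]
      refine lintegral_congr fun v ↦ ?_
      rw [lintegral_const_mul' _ _ ENNReal.ofReal_ne_top,
        lintegral_rpow_mul_exp_neg_mul_Ioi one_pos (by positivity), Gamma_one, mul_one,
        rpow_neg_one]
    _ ≤ _ := by
      rw [ENNReal.ofReal_mul (by positivity)]
      gcongr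
      exact lintegral_Ioi_inv_one_add_sq_le hγ hh

lemma cC_pos (d : ℕ) : 0 < cC d := by
  have := Gamma_pos_of_pos (show 0 < ((d : ℝ) + 1) / 2 by positivity)
  unfold cC
  positivity

lemma lintegral_halfSpace_fC_le {d : ℕ} (hd : 1 ≤ d) {a : EuclideanSpace ℝ (Fin d)} (ha : a ≠ 0)
    {γ : ℝ} (hγ : 0 < γ) :
    ∫⁻ n in {n : EuclideanSpace ℝ (Fin d) | ‖a‖ ^ 2 / 2 < ⟪a, n⟫}, ENNReal.ofReal (fC d γ n)
      ≤ ENNReal.ofReal (2 * γ / π * (1 / ‖a‖)) := by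
  have hna : 0 < ‖a‖ := norm_pos_iff.2 ha
  let i : Fin d := ⟨0, hd⟩
  obtain ⟨B, hB⟩ := Orthonormal.exists_orthonormalBasis_extension_of_card_eq (𝕜 := ℝ)
    (E := EuclideanSpace ℝ (Fin d)) (by simp) (v := fun _ : Fin d ↦ ‖a‖⁻¹ • a) (s := {i}) (by
      rw [orthonormal_subsingleton_iff]
      intro j
      simp [norm_smul, hna.ne'])
  have hBi : B i = ‖a‖⁻¹ • a := hB i rfl
  have hset : {n : EuclideanSpace ℝ (Fin d) | ‖a‖ ^ 2 / 2 < ⟪a, n⟫}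
      = {n | ‖a‖ / 2 < ⟪B i, n⟫} := by
    ext n
    simp only [Set.mem_ofPred_eq, hBi, inner_smul_left, conj_trivial]
    rw [← div_eq_inv_mul, lt_div_iff₀ hna]
    ring_nf
  have key := lintegral_halfSpace_rpow_le B i hγ (half_pos hna) rfl
  obtain ⟨m, rfl⟩ : ∃ m, d = m + 1 := ⟨d - 1, by omega⟩
  simp only [Fintype.card_fin, Nat.add_sub_cancel] at key
  have hp0 : 0 < (((m + 1 : ℕ) : ℝ) + 1) / 2 := by positivity
  have hΓ := Gamma_pos_of_pos hp0
  have hfac : cC (m + 1) * γ ^ (-((m + 1 : ℕ) : ℝ))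
      = π ^ (-((((m + 1 : ℕ) : ℝ) + 1) / 2)) * γ ^ (-((m + 1 : ℕ) : ℝ))
        * Real.Gamma ((((m + 1 : ℕ) : ℝ) + 1) / 2) := by
    rw [cC, rpow_neg pi_pos.le]
    ring
  have hval : π ^ (-((((m + 1 : ℕ) : ℝ) + 1) / 2)) * γ ^ (-((m + 1 : ℕ) : ℝ))
      * ((√π * γ) ^ m * (γ ^ 2 / (‖a‖ / 2))) = 2 * γ / π * (1 / ‖a‖) := by
    have h1 : π ^ ((((m + 1 : ℕ) : ℝ) + 1) / 2) = √π ^ m * π := by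
      rw [sqrt_eq_rpow, ← rpow_natCast, ← rpow_mul pi_pos.le, ← rpow_add_one pi_pos.ne']
      congr 1; push_cast; ring
    rw [rpow_neg pi_pos.le, h1, rpow_neg hγ.le, rpow_natCast]
    have : √π ≠ 0 := (sqrt_pos.2 pi_pos).ne'
    field_simp
    ring
  rw [hset]
  simp_rw [fC]
  have hc : 0 ≤ cC (m + 1) * γ ^ (-((m + 1 : ℕ) : ℝ)) := by
    have := cC_pos (m + 1)
    positivity
  simp_rw [ENNReal.ofReal_mul hc]
  rw [lintegral_const_mul' _ _ ENNReal.ofReal_ne_top, hfac, ENNReal.ofReal_mul (by positivity),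
    mul_assoc, ← hval]
  exact (mul_le_mul' le_rfl key).trans_eq (ENNReal.ofReal_mul (by positivity)).symm

lemma compl_vorT_subset {d : ℕ} (C : Finset (EuclideanSpace ℝ (Fin d)))
    [DecidableEq (EuclideanSpace ℝ (Fin d))] (x : EuclideanSpace ℝ (Fin d)) :
    (vorT (C : Set (EuclideanSpace ℝ (Fin d))) x)ᶜ
      ⊆ ⋃ c ∈ C.erase x, {n | ‖x - c‖ ^ 2 / 2 < ⟪c - x, n⟫} := by
  intro n hn
  have hnv : n + x ∉ vor (C : Set (EuclideanSpace ℝ (Fin d))) x := fun h ↦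
    hn ⟨n + x, h, by simp⟩
  simp only [vor, Set.mem_ofPred_eq, not_forall, not_le, add_sub_cancel_right] at hnv
  obtain ⟨c, hc, hlt⟩ := hnv
  have hcx : c ≠ x := by
    rintro rfl
    simp at hlt
  simp only [Set.mem_iUnion, Set.mem_ofPred_eq]
  refine ⟨c, Finset.mem_erase.2 ⟨hcx, hc⟩, ?_⟩
  have h1 : ‖n + x - c‖ ^ 2 < ‖n‖ ^ 2 := by gcongr
  rw [show n + x - c = n - (c - x) by abel, norm_sub_sq_real, norm_sub_rev c x,
    real_inner_comm] at h1
  linarith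

lemma Pe_le {d : ℕ} [DecidableEq (EuclideanSpace ℝ (Fin d))] (hd : 1 ≤ d)
    (C : Finset (EuclideanSpace ℝ (Fin d))) (x : EuclideanSpace ℝ (Fin d)) {γ : ℝ} (hγ : 0 < γ) :
    Pe (C : Set (EuclideanSpace ℝ (Fin d))) x γ
      ≤ (2 * γ / π) * ∑ c ∈ C.erase x, 1 / ‖x - c‖ := by
  have hf : Measurable (fC d γ) := by unfold fC; fun_prop
  have hf0 : ∀ n, 0 ≤ fC d γ n := fun n ↦ by
    have := cC_pos d
    unfold fC
    positivity
  rw [Pe, integral_eq_lintegral_of_nonneg_ae (ae_of_all _ hf0) hf.aestronglyMeasurable]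
  refine ENNReal.toReal_le_of_le_ofReal (by positivity) ?_
  rw [Finset.mul_sum, ENNReal.ofReal_sum_of_nonneg (fun _ _ ↦ by positivity)]
  calc
    _ ≤ ∫⁻ n in ⋃ c ∈ C.erase x, {n | ‖x - c‖ ^ 2 / 2 < ⟪c - x, n⟫}, ENNReal.ofReal (fC d γ n) :=
      lintegral_mono_set (compl_vorT_subset C x)
    _ ≤ ∑ c ∈ C.erase x,
          ∫⁻ n in {n | ‖x - c‖ ^ 2 / 2 < ⟪c - x, n⟫}, ENNReal.ofReal (fC d γ n) := by
      simp_rw [← withDensity_apply' (fun n ↦ ENNReal.ofReal (fC d γ n))]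
      exact measure_biUnion_finset_le _ _
    _ ≤ _ := by
      refine Finset.sum_le_sum fun c hc ↦ ?_
      rw [norm_sub_rev x c]
      exact lintegral_halfSpace_fC_le hd (sub_ne_zero.2 (Finset.ne_of_mem_erase hc)) hγ

theorem stmt5 (d : ℕ) [DecidableEq (EuclideanSpace ℝ (Fin d))] (hd : 1 ≤ d)
    (C : Finset (EuclideanSpace ℝ (Fin d)))
    (x : EuclideanSpace ℝ (Fin d)) (hx : x ∈ C) :
    ∃ K > (0 : ℝ), ∃ γ₀ > (0 : ℝ), ∀ γ : ℝ, 0 < γ → γ < γ₀ →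
      Pe (C : Set (EuclideanSpace ℝ (Fin d))) x γ
        ≤ (2 * γ / π) * ∑ c ∈ C.erase x, 1 / ‖x - c‖ + K * γ ^ 3 := by
  refine ⟨1, one_pos, 1, one_pos, fun γ hγ _ ↦ (Pe_le hd C x hγ).trans ?_⟩
  have : 0 < γ ^ 3 := by positivity
  linarith
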